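/- arXiv:1606.09016 — 3 statements merged into one kernel-verified Lean document; each statement's English description precedes it below -/
import Mathlib

section
/- Convergence of 𝔖 (unique normal forms): every word w over {s_1, …, s_{n-1}} rewrites in 𝔖 to some irreducible word, and any two irreducible words reachable from w by rewriting are ≈-equivalent. -/
/-!
Fix `n ≥ 1`; we write `n = m + 1` where `m : ℕ`, so that words are lists over the
alphabet `{s_1, …, s_{n-1}}`, formalized as `List (Fin m)`: the letter `i : Fin m`
denotes the adjacent transposition `(i, i+1)` of `Fin (m+1)`.
-/

/-- Words over the alphabet `{s_1, …, s_{n-1}}` with `n = m + 1`. -/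
abbrev Word (m : ℕ) := List (Fin m)

/-- The letter `s_i` as the adjacent transposition `(i, i+1)` of `{1, …, n}`. -/
def toSwap {m : ℕ} (i : Fin m) : Equiv.Perm (Fin (m + 1)) :=
  Equiv.swap i.castSucc i.succ

/-- Evaluation of a word: the composite of the transpositions taken in the order
in which they occur in the word (the leftmost letter is applied first). -/
def eval {m : ℕ} (w : Word m) : Equiv.Perm (Fin (m + 1)) :=
  (w.map toSwap).reverse.prod

/-- The interchange equivalence `≈`: the smallest congruence on words (compatible
with concatenation) generated by `s_i s_j ≈ s_j s_i` whenever `|i - j| ≥ 2`. -/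
inductive Interchange {m : ℕ} : Word m → Word m → Prop
  | swap (u v : Word m) (i j : Fin m)
      (h : (i : ℕ) + 2 ≤ (j : ℕ) ∨ (j : ℕ) + 2 ≤ (i : ℕ)) :
      Interchange (u ++ [i, j] ++ v) (u ++ [j, i] ++ v)
  | refl (w : Word m) : Interchange w w
  | symm {w w' : Word m} : Interchange w w' → Interchange w' w
  | trans {w₁ w₂ w₃ : Word m} :
      Interchange w₁ w₂ → Interchange w₂ w₃ → Interchange w₁ w₃

/-- The rules of the rewriting system `𝔖`:
`s_i s_i ⇒ ε` and `s_i s_{i+1} s_i ⇒ s_{i+1} s_i s_{i+1}`. -/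
inductive Rule {m : ℕ} : Word m → Word m → Prop
  | del (i : Fin m) : Rule [i, i] []
  | yb (i j : Fin m) (h : (j : ℕ) = (i : ℕ) + 1) : Rule [i, j, i] [j, i, j]

/-- One rewriting step of `𝔖`, applied inside an arbitrary context and modulo `≈`:
`w ⇒ w'` iff `w ≈ u·l·v` and `w' ≈ u·r·v` for some rule `l ⇒ r` and words `u, v`. -/
def Step {m : ℕ} (w w' : Word m) : Prop :=
  ∃ u v l r, Rule l r ∧ Interchange w (u ++ l ++ v) ∧ Interchange w' (u ++ r ++ v)

/-- `⇒*`: the reflexive–transitive closure of the union of the one-step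
rewriting relation `⇒` and the interchange equivalence `≈`. -/
def StepStar {m : ℕ} : Word m → Word m → Prop :=
  Relation.ReflTransGen (fun w w' => Step w w' ∨ Interchange w w')

/-- A word is irreducible if no word `≈`-equivalent to it contains the left-hand
side of a rule as a factor. -/
def IrreducibleWord {m : ℕ} (w : Word m) : Prop :=
  ∀ u v l r : Word m, Rule l r → ¬ Interchange w (u ++ l ++ v)

namespace Interchange

variable {m : ℕ}

theorem context (p q : Word m) {w w' : Word m} (h : Interchange w w') :
    Interchange (p ++ w ++ q) (p ++ w' ++ q) := by
  induction h with
  | swap u v i j h => simpa using swap (p ++ u) (v ++ q) i j h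
  | refl w => exact refl _
  | symm _ ih => exact ih.symm
  | trans _ _ ih₁ ih₂ => exact ih₁.trans ih₂

theorem append_left (p : Word m) {w w' : Word m} (h : Interchange w w') :
    Interchange (p ++ w) (p ++ w') := by
  simpa using h.context p []

theorem append_right (q : Word m) {w w' : Word m} (h : Interchange w w') :
    Interchange (w ++ q) (w' ++ q) := by
  simpa using h.context [] q

theorem cons (i : Fin m) {w w' : Word m} (h : Interchange w w') :
    Interchange (i :: w) (i :: w') :=
  h.append_left [i]

theorem perm {w w' : Word m} (h : Interchange w w') : w.Perm w' := by
  induction h with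
  | swap u v i j h => exact ((List.Perm.swap j i []).append_left u).append_right v
  | refl w => exact List.Perm.refl w
  | symm _ ih => exact ih.symm
  | trans _ _ ih₁ ih₂ => exact ih₁.trans ih₂

/-- A letter can be moved across a word all of whose letters are far above it. -/
theorem cons_append_comm (i : Fin m) (u v : Word m) (hu : ∀ j ∈ u, (i : ℕ) + 2 ≤ j) :
    Interchange (i :: (u ++ v)) (u ++ i :: v) := by
  induction u with
  | nil => exact refl _
  | cons j u ih =>
    have h := swap [] (u ++ v) i j (Or.inl (hu j (by simp)))
    exact h.trans ((ih fun k hk => hu k (by simp [hk])).cons j)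

end Interchange

namespace IrreducibleWord

variable {m : ℕ}

theorem of_interchange {w w' : Word m} (hw : IrreducibleWord w) (h : Interchange w w') :
    IrreducibleWord w' :=
  fun u v l r hr h' => hw u v l r hr (h.trans h')

theorem of_context {p w q : Word m} (hw : IrreducibleWord (p ++ w ++ q)) : IrreducibleWord w := by
  intro u v l r hr h
  apply hw (p ++ u) (v ++ q) l r hr
  simpa using h.context p q

theorem of_append_left {w q : Word m} (hw : IrreducibleWord (w ++ q)) : IrreducibleWord w :=
  of_context (p := []) (q := q) (by simpa using hw)

theorem of_cons {i : Fin m} {w : Word m} (hw : IrreducibleWord (i :: w)) : IrreducibleWord w :=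
  of_context (p := [i]) (q := []) (by simpa using hw)

end IrreducibleWord

/-- `IsRun a w` says that `w` is an increasing run `s_a s_{a+1} ⋯ s_{b-1}` of consecutive
letters, possibly empty. -/
inductive IsRun {m : ℕ} : ℕ → Word m → Prop
  | nil (a : ℕ) : IsRun a []
  | cons (i : Fin m) (w : Word m) : IsRun ((i : ℕ) + 1) w → IsRun i (i :: w)

namespace IsRun

variable {m : ℕ}

theorem le_of_mem {a : ℕ} {w : Word m} (h : IsRun a w) : ∀ j ∈ w, a ≤ (j : ℕ) := by
  induction h with
  | nil a => simp
  | cons i w _ ih =>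
    intro j hj
    rcases List.mem_cons.1 hj with rfl | hj
    · exact le_rfl
    · exact (Nat.le_succ _).trans (ih j hj)

theorem eq_of_length_eq {a : ℕ} {w w' : Word m} (h : IsRun a w) (h' : IsRun a w')
    (hl : w.length = w'.length) : w = w' := by
  induction h generalizing w' with
  | nil a => exact (List.length_eq_zero_iff.1 hl.symm).symm
  | cons i w _ ih =>
    generalize hb : (i : ℕ) = b at h'
    cases h' with
    | nil => simp at hl
    | cons j w' h' =>
      obtain rfl := Fin.ext hb
      rw [ih h' (by simpa using hl)]

end IsRun

section Eval

variable {m : ℕ}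

theorem eval_append (u v : Word m) : eval (u ++ v) = eval v * eval u := by
  simp [eval]

theorem eval_cons (i : Fin m) (w : Word m) : eval (i :: w) = eval w * toSwap i := by
  simp [eval]

theorem toSwap_apply_of_lt {i : Fin m} {x : Fin (m + 1)} (h : (x : ℕ) < i) : toSwap i x = x :=
  Equiv.swap_apply_of_ne_of_ne (by simp [Fin.ext_iff]; lia) (by simp [Fin.ext_iff]; lia)

theorem eval_apply_of_lt {w : Word m} {x : Fin (m + 1)} (h : ∀ i ∈ w, (x : ℕ) < i) :
    eval w x = x := by
  induction w with
  | nil => simp [eval]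
  | cons i w ih =>
    rw [eval_cons, Equiv.Perm.mul_apply, toSwap_apply_of_lt (h i (by simp)),
      ih fun j hj => h j (by simp [hj])]

theorem IsRun.eval_apply {a : ℕ} {w : Word m} (h : IsRun a w) (x : Fin (m + 1)) (hx : (x : ℕ) = a) :
    (eval w x : ℕ) = a + w.length := by
  induction h generalizing x with
  | nil a => simp [eval, hx]
  | cons i w _ ih =>
    obtain rfl : x = i.castSucc := Fin.ext hx
    rw [eval_cons, Equiv.Perm.mul_apply, toSwap, Equiv.swap_apply_left, ih _ (by simp)]
    simp
    lia

theorem toSwap_comm {i j : Fin m} (h : (i : ℕ) + 2 ≤ j ∨ (j : ℕ) + 2 ≤ i) :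
    toSwap i * toSwap j = toSwap j * toSwap i := by
  apply (Equiv.Perm.Disjoint.commute _).eq
  rw [toSwap, toSwap, Equiv.Perm.disjoint_iff_eq_or_eq]
  intro x
  by_cases hx : x = i.castSucc ∨ x = i.succ
  · right
    apply Equiv.swap_apply_of_ne_of_ne <;>
      (rcases hx with rfl | rfl <;> simp [Fin.ext_iff] <;> lia)
  · left
    rw [not_or] at hx
    exact Equiv.swap_apply_of_ne_of_ne hx.1 hx.2

theorem toSwap_braid {i j : Fin m} (h : (j : ℕ) = i + 1) :
    toSwap i * toSwap j * toSwap i = toSwap j * toSwap i * toSwap j := by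
  have hc : j.castSucc = i.succ := Fin.ext (by simpa using h)
  have h₁ : i.castSucc ≠ i.succ := by simp [Fin.ext_iff]
  have h₂ : i.castSucc ≠ j.succ := by simp [Fin.ext_iff]; lia
  have h₃ : i.succ ≠ j.succ := by simp [Fin.ext_iff]; lia
  rw [toSwap, toSwap, hc, Equiv.swap_mul_swap_mul_swap h₁ h₂, Equiv.swap_comm i.castSucc,
    Equiv.swap_comm i.succ j.succ, Equiv.swap_mul_swap_mul_swap h₃.symm h₂.symm, Equiv.swap_comm]

theorem Interchange.eval_eq {w w' : Word m} (h : Interchange w w') : eval w = eval w' := by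
  induction h with
  | swap u v i j h => simp [eval_append, eval_cons, mul_assoc, toSwap_comm h]
  | refl w => rfl
  | symm _ ih => exact ih.symm
  | trans _ _ ih₁ ih₂ => exact ih₁.trans ih₂

theorem Rule.eval_eq {l r : Word m} (h : Rule l r) : eval l = eval r := by
  cases h with
  | del i => simp [eval, toSwap]
  | yb i j h => simpa [eval, mul_assoc] using toSwap_braid h

theorem Step.eval_eq {w w' : Word m} (h : Step w w') : eval w = eval w' := by
  obtain ⟨u, v, l, r, hr, h, h'⟩ := h
  simp only [h.eval_eq, h'.eval_eq, eval_append, hr.eval_eq]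

theorem StepStar.eval_eq {w w' : Word m} (h : StepStar w w') : eval w = eval w' := by
  induction h with
  | refl => rfl
  | tail _ h ih => exact ih.trans (h.elim Step.eval_eq Interchange.eval_eq)

end Eval

/-- An irreducible word in the letters `s_a, s_{a+1}, …` factors, up to interchange, as a word in
the letters `s_{a+1}, …` followed by an increasing run starting at `s_a`. -/
theorem IrreducibleWord.exists_run {m : ℕ} {a : ℕ} {w : Word m} (hw : IrreducibleWord w)
    (ha : ∀ i ∈ w, a ≤ (i : ℕ)) :
    ∃ u r : Word m, (∀ i ∈ u, a + 1 ≤ (i : ℕ)) ∧ IsRun a r ∧ Interchange w (u ++ r) := by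
  obtain ⟨k, hk⟩ : ∃ k, m ≤ a + k := ⟨m, Nat.le_add_left _ _⟩
  induction k generalizing a w with
  | zero =>
    refine ⟨[], [], by simp, .nil a, ?_⟩
    obtain rfl : w = [] := List.eq_nil_iff_forall_not_mem.2 fun i hi => by
      have := ha i hi
      lia
    exact .refl _
  | succ k ihk =>
    induction w with
    | nil => exact ⟨[], [], by simp, .nil a, .refl _⟩
    | cons x w ihw =>
      obtain ⟨u, r, hu, hr, h⟩ := ihw hw.of_cons fun i hi => ha i (by simp [hi])
      have hxw := h.cons x
      rcases (ha x (by simp)).lt_or_eq with hx | hx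
      · exact ⟨x :: u, r, by simpa using ⟨hx, hu⟩, hr, hxw⟩
      have hw' := hw.of_interchange hxw
      subst hx
      obtain ⟨u', r', hu', hr', h'⟩ :=
        ihk (a := x + 1) (w := u) hw'.of_cons.of_append_left hu (by lia)
      have hmove : Interchange (x :: w) (u' ++ x :: (r' ++ r)) := by
        refine hxw.trans (((h'.append_right r).cons x).trans ?_)
        simpa using Interchange.cons_append_comm x u' (r' ++ r) hu'
      have hw'' := hw.of_interchange hmove
      generalize hb : (x : ℕ) = b at hr
      cases hr with
      | nil =>
        refine ⟨u', x :: r', fun i hi => ?_, ?_, by simpa using hmove⟩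
        · have := hu' i hi
          lia
        · rw [← hb]
          exact .cons x r' hr'
      | cons y r =>
        obtain rfl := Fin.ext hb
        exfalso
        generalize hc : (x : ℕ) + 1 = c at hr'
        cases hr' with
        | nil => exact hw'' u' r _ _ (.del x) (by simpa using Interchange.refl _)
        | cons z r' hr' =>
          refine hw'' u' (r' ++ r) _ _ (.yb x z hc.symm) ?_
          have hcomm := (Interchange.cons_append_comm x r' r fun j hj => by
            have := hr'.le_of_mem j hj
            lia).symm
          simpa using hcomm.append_left (u' ++ [x, z])

theorem IrreducibleWord.interchange_of_eval_eq_of_le {m : ℕ} {a : ℕ} {w₁ w₂ : Word m}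
    (h₁ : IrreducibleWord w₁) (h₂ : IrreducibleWord w₂) (ha₁ : ∀ i ∈ w₁, a ≤ (i : ℕ))
    (ha₂ : ∀ i ∈ w₂, a ≤ (i : ℕ)) (h : eval w₁ = eval w₂) : Interchange w₁ w₂ := by
  obtain ⟨k, hk⟩ : ∃ k, m ≤ a + k := ⟨m, Nat.le_add_left _ _⟩
  induction k generalizing a w₁ w₂ with
  | zero =>
    have hnil : ∀ w : Word m, (∀ i ∈ w, a ≤ (i : ℕ)) → w = [] := fun w hw =>
      List.eq_nil_iff_forall_not_mem.2 fun i hi => by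
        have := hw i hi
        lia
    rw [hnil w₁ ha₁, hnil w₂ ha₂]
    exact .refl _
  | succ k ih =>
    by_cases ham : m ≤ a
    · exact ih h₁ h₂ ha₁ ha₂ h (by lia)
    obtain ⟨u₁, r₁, hu₁, hr₁, e₁⟩ := h₁.exists_run ha₁
    obtain ⟨u₂, r₂, hu₂, hr₂, e₂⟩ := h₂.exists_run ha₂
    rw [e₁.eval_eq, e₂.eval_eq, eval_append, eval_append] at h
    let x : Fin (m + 1) := ⟨a, by lia⟩
    have hx := congrArg (fun σ : Equiv.Perm (Fin (m + 1)) => (σ x : ℕ)) h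
    simp only [Equiv.Perm.mul_apply] at hx
    rw [eval_apply_of_lt (x := x) hu₁, eval_apply_of_lt (x := x) hu₂, hr₁.eval_apply x rfl,
      hr₂.eval_apply x rfl] at hx
    obtain rfl := hr₁.eq_of_length_eq hr₂ (Nat.add_left_cancel hx)
    have hu := ih (h₁.of_interchange e₁).of_append_left (h₂.of_interchange e₂).of_append_left
      hu₁ hu₂ (mul_left_cancel h) (by lia)
    exact e₁.trans ((hu.append_right r₁).trans e₂.symm)

/-- Irreducible words representing the same permutation are interchange equivalent. -/
theorem IrreducibleWord.interchange_of_eval_eq {m : ℕ} {w₁ w₂ : Word m}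
    (h₁ : IrreducibleWord w₁) (h₂ : IrreducibleWord w₂) (h : eval w₁ = eval w₂) :
    Interchange w₁ w₂ :=
  h₁.interchange_of_eval_eq_of_le (a := 0) h₂ (by simp) (by simp) h

/-- An interchange-invariant weight that each rule strictly decreases: every letter has positive
weight, and letters with larger index weigh less. -/
def weight {m : ℕ} (w : Word m) : ℕ :=
  (w.map fun i : Fin m => 2 * m - (i : ℕ)).sum

theorem weight_append {m : ℕ} (u v : Word m) : weight (u ++ v) = weight u + weight v := by
  simp [weight]

theorem Interchange.weight_eq {m : ℕ} {w w' : Word m} (h : Interchange w w') :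
    weight w = weight w' :=
  (h.perm.map _).sum_eq

theorem Rule.weight_lt {m : ℕ} {l r : Word m} (h : Rule l r) : weight r < weight l := by
  cases h with
  | del i => simp [weight]; lia
  | yb i j h => simp [weight]; lia

theorem exists_stepStar_irreducibleWord {m : ℕ} (w : Word m) :
    ∃ w' : Word m, StepStar w w' ∧ IrreducibleWord w' := by
  induction hn : weight w using Nat.strong_induction_on generalizing w with
  | _ n ih =>
    by_cases hw : IrreducibleWord w
    · exact ⟨w, .refl, hw⟩
    · simp only [IrreducibleWord, not_forall, not_not] at hw
      obtain ⟨u, v, l, r, hr, h⟩ := hw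
      have hlt : weight (u ++ r ++ v) < n := by
        rw [← hn, h.weight_eq]
        simp only [weight_append]
        have := hr.weight_lt
        lia
      obtain ⟨w', hs, hw'⟩ := ih _ hlt _ rfl
      exact ⟨w', .head (Or.inl ⟨u, v, l, r, hr, h, .refl _⟩) hs, hw'⟩

/-- Convergence of `𝔖` (unique normal forms): every word `w`
rewrites in `𝔖` to some irreducible word, and any two irreducible words reachable
from `w` by rewriting are `≈`-equivalent. -/
theorem step_convergent {m : ℕ} (w : Word m) :
    (∃ w' : Word m, StepStar w w' ∧ IrreducibleWord w') ∧
      (∀ w₁ w₂ : Word m, StepStar w w₁ → StepStar w w₂ →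
        IrreducibleWord w₁ → IrreducibleWord w₂ → Interchange w₁ w₂) :=
  ⟨exists_stepStar_irreducibleWord w, fun _ _ s₁ s₂ h₁ h₂ =>
    h₁.interchange_of_eval_eq h₂ (s₁.eval_eq.symm.trans s₂.eval_eq)⟩
end

section
/- Interpretation of proofs in Σ_MLLu: for every list of MLLc formulas Γ, if the sequent ⊢ Γ is derivable in MLLc (multiplicative linear logic with units), then there exists a proof diagram from the empty word to Γ, i.e. the empty word rewrites to the word Γ in the system Σ_MLLu. -/
/-- MLLc formulas: generated from a countable set of atoms `a` and their duals
`a⊥`, the units `1` and `⊥`, and the binary connectives `⊗` and `⅋`. -/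
inductive MLLcFormula : Type
  | pos : ℕ → MLLcFormula          -- an atom `a`
  | neg : ℕ → MLLcFormula          -- a dual atom `a⊥`
  | one : MLLcFormula              -- the unit `1`
  | bot : MLLcFormula              -- the unit `⊥`
  | tensor : MLLcFormula → MLLcFormula → MLLcFormula
  | parr : MLLcFormula → MLLcFormula → MLLcFormula

namespace MLLcFormula

/-- Linear negation: the involution with `(a)⊥ = a⊥`, `(a⊥)⊥ = a`, `1⊥ = ⊥`,
`⊥⊥ = 1`, `(A⊗B)⊥ = B⊥ ⅋ A⊥` and `(A⅋B)⊥ = B⊥ ⊗ A⊥`. -/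
def dual : MLLcFormula → MLLcFormula
  | pos a => neg a
  | neg a => pos a
  | one => bot
  | bot => one
  | tensor A B => parr (dual B) (dual A)
  | parr A B => tensor (dual B) (dual A)

end MLLcFormula

/-- MLLc derivability `⊢ Γ`, the least predicate closed under the rules `Ax`,
`Cut`, `⊗`, `⅋`, `1`, `⊥` and exchange. -/
inductive MLLcProof : List MLLcFormula → Prop
  | ax (A : MLLcFormula) : MLLcProof [A, A.dual]
  | cut (S Γ : List MLLcFormula) (A : MLLcFormula) :
      MLLcProof (S ++ [A]) → MLLcProof (Γ ++ [A.dual]) → MLLcProof (S ++ Γ)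
  | tensor (S Γ : List MLLcFormula) (A B : MLLcFormula) :
      MLLcProof (S ++ [A]) → MLLcProof (B :: Γ) →
      MLLcProof (S ++ [A.tensor B] ++ Γ)
  | parr (S : List MLLcFormula) (A B : MLLcFormula) :
      MLLcProof (S ++ [A, B]) → MLLcProof (S ++ [A.parr B])
  | one : MLLcProof [MLLcFormula.one]
  | bot (S : List MLLcFormula) : MLLcProof S → MLLcProof (S ++ [MLLcFormula.bot])
  | exchange (Γ Γ' : List MLLcFormula) :
      MLLcProof Γ → Γ.Perm Γ' → MLLcProof Γ'

/-- One rewriting step for a set `gen` of generators: replace, inside an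
arbitrary context, a contiguous factor matching a generator's source by its
target. -/
def CtxStep {α : Type} (gen : List α → List α → Prop) (w w' : List α) : Prop :=
  ∃ u v l r, gen l r ∧ w = u ++ l ++ v ∧ w' = u ++ r ++ v

/-- The generators of the system `Σ_MLLu`. -/
inductive MLLuGen : List MLLcFormula → List MLLcFormula → Prop
  | ax (A : MLLcFormula) : MLLuGen [] [A, A.dual]
  | tensor (A B : MLLcFormula) : MLLuGen [A, B] [A.tensor B]
  | parr (A B : MLLcFormula) : MLLuGen [A, B] [A.parr B]
  | cut (A : MLLcFormula) : MLLuGen [A, A.dual] []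
  | swap (A B : MLLcFormula) : MLLuGen [A, B] [B, A]
  | one : MLLuGen [] [MLLcFormula.one]
  | bot : MLLuGen [] [MLLcFormula.bot]

theorem CtxStep.of_gen {α : Type} {gen : List α → List α → Prop} {l r : List α}
    (h : gen l r) (u v : List α) : CtxStep gen (u ++ l ++ v) (u ++ r ++ v) :=
  ⟨u, v, l, r, h, rfl, rfl⟩

theorem CtxStep.append_context {α : Type} {gen : List α → List α → Prop} {w w' : List α}
    (h : CtxStep gen w w') (x y : List α) : CtxStep gen (x ++ w ++ y) (x ++ w' ++ y) := by
  obtain ⟨u, v, l, r, hg, rfl, rfl⟩ := h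
  exact ⟨x ++ u, v ++ y, l, r, hg, by simp, by simp⟩

theorem CtxStep.reflTransGen_append_context {α : Type} {gen : List α → List α → Prop}
    {w w' : List α} (h : Relation.ReflTransGen (CtxStep gen) w w') (x y : List α) :
    Relation.ReflTransGen (CtxStep gen) (x ++ w ++ y) (x ++ w' ++ y) :=
  h.lift (fun z => x ++ z ++ y) fun _ _ hs => hs.append_context x y

/-- Derivations from the empty word can be juxtaposed. -/
theorem CtxStep.reflTransGen_nil_append {α : Type} {gen : List α → List α → Prop}
    {w w' : List α} (h : Relation.ReflTransGen (CtxStep gen) [] w)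
    (h' : Relation.ReflTransGen (CtxStep gen) [] w') :
    Relation.ReflTransGen (CtxStep gen) [] (w ++ w') :=
  h.trans (by simpa using reflTransGen_append_context h' w [])

/-- The swap generators realise every permutation of a word. -/
theorem MLLuGen.reflTransGen_of_perm {w w' : List MLLcFormula} (h : w.Perm w') :
    Relation.ReflTransGen (CtxStep MLLuGen) w w' := by
  induction h with
  | nil => exact .refl
  | cons A _ ih => simpa using CtxStep.reflTransGen_append_context ih [A] []
  | swap A B l => exact .single (CtxStep.of_gen (MLLuGen.swap B A) [] l)
  | trans _ _ ih₁ ih₂ => exact ih₁.trans ih₂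

/-- Interpretation of proofs in `Σ_MLLu`: if `⊢ Γ` is derivable
in MLLc, then the empty word rewrites to the word `Γ` in the system `Σ_MLLu`. -/
theorem mllu_interpretation (Γ : List MLLcFormula) (h : MLLcProof Γ) :
    Relation.ReflTransGen (CtxStep MLLuGen) [] Γ := by
  induction h with
  | ax A => exact .single (CtxStep.of_gen (MLLuGen.ax A) [] [])
  | cut S Γ A _ _ ih₁ ih₂ =>
    have hperm : (S ++ [A] ++ (Γ ++ [A.dual])).Perm (S ++ [A, A.dual] ++ Γ) := by
      simpa using (List.perm_append_singleton A.dual Γ).append_left (S ++ [A])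
    simpa using ((CtxStep.reflTransGen_nil_append ih₁ ih₂).trans
      (MLLuGen.reflTransGen_of_perm hperm)).tail (CtxStep.of_gen (MLLuGen.cut A) S Γ)
  | tensor S Γ A B _ _ ih₁ ih₂ =>
    have hpair := CtxStep.reflTransGen_nil_append ih₁ ih₂
    rw [show S ++ [A] ++ B :: Γ = S ++ [A, B] ++ Γ by simp] at hpair
    exact hpair.tail (CtxStep.of_gen (MLLuGen.tensor A B) S Γ)
  | parr S A B _ ih =>
    exact ih.tail (by simpa using CtxStep.of_gen (MLLuGen.parr A B) S [])
  | one => exact .single (CtxStep.of_gen MLLuGen.one [] [])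
  | bot S _ ih => exact ih.tail (by simpa using CtxStep.of_gen MLLuGen.bot S [])
  | exchange Γ Γ' _ hperm ih => exact ih.trans (MLLuGen.reflTransGen_of_perm hperm)
end

section
/- Proof diagram correspondence for MLL with control: for every list of MLL formulas Γ, the sequent ⊢ Γ is derivable in MLL if and only if there exists a controlled proof diagram from the empty word to the word L, Γ, R, i.e. the empty word rewrites to L, Γ, R in the control system Σ̃_MLL. -/
/-- MLL formulas: generated from a countable set of atoms `a` and their duals
`a⊥` by the binary connectives `⊗` and `⅋`. -/
inductive MLLFormula : Type
  | pos : ℕ → MLLFormula          -- an atom `a`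
  | neg : ℕ → MLLFormula          -- a dual atom `a⊥`
  | tensor : MLLFormula → MLLFormula → MLLFormula
  | parr : MLLFormula → MLLFormula → MLLFormula

namespace MLLFormula

/-- Linear negation: the involution with `(a)⊥ = a⊥`, `(a⊥)⊥ = a`,
`(A⊗B)⊥ = B⊥ ⅋ A⊥` and `(A⅋B)⊥ = B⊥ ⊗ A⊥`. -/
def dual : MLLFormula → MLLFormula
  | pos a => neg a
  | neg a => pos a
  | tensor A B => parr (dual B) (dual A)
  | parr A B => tensor (dual B) (dual A)

end MLLFormula

/-- MLL derivability `⊢ Γ`, the least predicate closed under the rules `Ax`,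
`Cut`, `⊗`, `⅋` and exchange. -/
inductive MLLProof : List MLLFormula → Prop
  | ax (A : MLLFormula) : MLLProof [A, A.dual]
  | cut (S Γ : List MLLFormula) (A : MLLFormula) :
      MLLProof (S ++ [A]) → MLLProof (Γ ++ [A.dual]) → MLLProof (S ++ Γ)
  | tensor (S Γ : List MLLFormula) (A B : MLLFormula) :
      MLLProof (S ++ [A]) → MLLProof (B :: Γ) →
      MLLProof (S ++ [A.tensor B] ++ Γ)
  | parr (S : List MLLFormula) (A B : MLLFormula) :
      MLLProof (S ++ [A, B]) → MLLProof (S ++ [A.parr B])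
  | exchange (Γ Γ' : List MLLFormula) :
      MLLProof Γ → Γ.Perm Γ' → MLLProof Γ'

/-- Labels: MLL formulas together with the two control colors `L` and `R`. -/
inductive MLLLabel : Type
  | fm : MLLFormula → MLLLabel
  | L : MLLLabel
  | R : MLLLabel

/-- The generators of the control system `Σ̃_MLL` (the colors `L` and `R` are
never swapped). -/
inductive CtrlGen : List MLLLabel → List MLLLabel → Prop
  | ax (A : MLLFormula) :
      CtrlGen [] [.L, .fm A, .fm A.dual, .R]
  | tensor (A B : MLLFormula) :
      CtrlGen [.fm A, .R, .L, .fm B] [.fm (A.tensor B)]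
  | parr (A B : MLLFormula) :
      CtrlGen [.fm A, .fm B] [.fm (A.parr B)]
  | cut (A : MLLFormula) :
      CtrlGen [.fm A, .R, .L, .fm A.dual] []
  | swap (A B : MLLFormula) :
      CtrlGen [.fm A, .fm B] [.fm B, .fm A]

/-- Reading a word with current sequent `acc` and enclosing unfinished sequents `stk`: every `R`
closes a block `L ... R` whose formulas, nested blocks aside, form a derivable sequent. -/
def BlocksDerivable : List MLLLabel → List MLLFormula → List (List MLLFormula) → Prop
  | [], _, _ => True
  | .fm A :: w, acc, stk => BlocksDerivable w (acc ++ [A]) stk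
  | .L :: w, acc, stk => BlocksDerivable w [] (acc :: stk)
  | .R :: w, acc, p :: stk => MLLProof acc ∧ BlocksDerivable w p stk
  | .R :: _, _, [] => False

/-- `Γ'` is derivable from `Γ` in every right context. -/
def SequentEntails (Γ Γ' : List MLLFormula) : Prop :=
  ∀ Δ, MLLProof (Γ ++ Δ) → MLLProof (Γ' ++ Δ)

theorem SequentEntails.rfl {Γ : List MLLFormula} : SequentEntails Γ Γ := fun _ h => h

theorem SequentEntails.append {Γ Γ' : List MLLFormula} (h : SequentEntails Γ Γ')
    (Δ : List MLLFormula) : SequentEntails (Γ ++ Δ) (Γ' ++ Δ) := by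
  intro Θ hΘ
  rw [List.append_assoc] at hΘ ⊢
  exact h _ hΘ

theorem SequentEntails.of_perm {Γ Γ' : List MLLFormula} (h : Γ.Perm Γ') :
    SequentEntails Γ Γ' :=
  fun Δ hΔ => .exchange _ _ hΔ (h.append_right Δ)

theorem SequentEntails.parr (Γ : List MLLFormula) (A B : MLLFormula) :
    SequentEntails (Γ ++ [A, B]) (Γ ++ [A.parr B]) := by
  intro Δ h
  have h₁ : MLLProof ((Γ ++ Δ) ++ [A, B]) := by
    refine .exchange _ _ h ?_
    rw [List.append_assoc, List.append_assoc]
    exact List.perm_append_comm.append_left Γ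
  refine .exchange _ _ (h₁.parr _ A B) ?_
  rw [List.append_assoc, List.append_assoc]
  exact List.perm_append_comm.append_left Γ

theorem SequentEntails.tensor {Γ : List MLLFormula} {A : MLLFormula} (B : MLLFormula)
    (h : MLLProof (Γ ++ [A])) : SequentEntails [B] (Γ ++ [A.tensor B]) :=
  fun Δ hΔ => .tensor Γ Δ A B h hΔ

theorem SequentEntails.cut {Γ : List MLLFormula} {A : MLLFormula}
    (h : MLLProof (Γ ++ [A])) : SequentEntails [A.dual] Γ :=
  fun Δ hΔ => .cut Γ Δ A h (.exchange _ _ hΔ List.perm_append_comm)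

theorem BlocksDerivable.mono {w : List MLLLabel} {acc acc' : List MLLFormula}
    {stk stk' : List (List MLLFormula)} (h : BlocksDerivable w acc stk)
    (hacc : SequentEntails acc acc') (hstk : List.Forall₂ SequentEntails stk stk') :
    BlocksDerivable w acc' stk' := by
  induction w generalizing acc acc' stk stk' with
  | nil => trivial
  | cons x w ih =>
    cases x with
    | fm A => exact ih (acc := acc ++ [A]) h (hacc.append [A]) hstk
    | L => exact ih (acc := []) (stk := acc :: stk) h .rfl (.cons hacc hstk)
    | R =>
      cases hstk with
      | nil => exact h
      | cons hp hs => exact ⟨by simpa using hacc [] (by simpa using h.1), ih h.2 hp hs⟩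

theorem BlocksDerivable.mono_left {w : List MLLLabel} {acc acc' : List MLLFormula}
    {stk : List (List MLLFormula)} (h : BlocksDerivable w acc stk)
    (hacc : SequentEntails acc acc') : BlocksDerivable w acc' stk :=
  h.mono hacc (List.forall₂_same.2 fun _ _ => .rfl)

theorem CtrlGen.blocksDerivable {l r : List MLLLabel} (hg : CtrlGen l r) {v : List MLLLabel}
    {acc : List MLLFormula} {stk : List (List MLLFormula)}
    (h : BlocksDerivable (l ++ v) acc stk) : BlocksDerivable (r ++ v) acc stk := by
  cases hg with
  | ax A => exact ⟨.ax A, h⟩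
  | tensor A B =>
    cases stk with
    | nil => exact h.elim
    | cons p s => exact h.2.mono_left (acc := [B]) (.tensor B h.1)
  | parr A B =>
    refine BlocksDerivable.mono_left (w := v) (acc := acc ++ [A] ++ [B])
      (acc' := acc ++ [A.parr B]) h ?_
    simpa using SequentEntails.parr acc A B
  | cut A =>
    cases stk with
    | nil => exact h.elim
    | cons p s => exact h.2.mono_left (acc := [A.dual]) (.cut h.1)
  | swap A B =>
    refine BlocksDerivable.mono_left (w := v) (acc := acc ++ [A] ++ [B])
      (acc' := acc ++ [B] ++ [A]) h (.of_perm ?_)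
    rw [List.append_assoc, List.append_assoc]
    exact (List.Perm.swap B A []).append_left acc

theorem CtxStep.blocksDerivable {w w' : List MLLLabel} (hs : CtxStep CtrlGen w w')
    {acc : List MLLFormula} {stk : List (List MLLFormula)} (h : BlocksDerivable w acc stk) :
    BlocksDerivable w' acc stk := by
  obtain ⟨u, v, l, r, hg, rfl, rfl⟩ := hs
  simp only [List.append_assoc] at h ⊢
  induction u generalizing acc stk with
  | nil => exact hg.blocksDerivable h
  | cons x u ih =>
    cases x with
    | fm A => exact ih (acc := acc ++ [A]) h
    | L => exact ih (acc := []) (stk := acc :: stk) h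
    | R =>
      cases stk with
      | nil => exact h.elim
      | cons p s => exact ⟨h.1, ih h.2⟩

theorem BlocksDerivable.mllProof {Γ acc p : List MLLFormula} {stk : List (List MLLFormula)}
    (h : BlocksDerivable (Γ.map MLLLabel.fm ++ [MLLLabel.R]) acc (p :: stk)) :
    MLLProof (acc ++ Γ) := by
  induction Γ generalizing acc with
  | nil => simpa using h.1
  | cons A Γ ih => simpa using ih (acc := acc ++ [A]) h

theorem CtxStep.reflTransGen_context {α : Type} {gen : List α → List α → Prop}
    {w w' : List α} (h : Relation.ReflTransGen (CtxStep gen) w w') (u v : List α) :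
    Relation.ReflTransGen (CtxStep gen) (u ++ w ++ v) (u ++ w' ++ v) := by
  refine h.lift (fun x => u ++ x ++ v) ?_
  rintro _ _ ⟨a, b, l, r, hg, rfl, rfl⟩
  exact ⟨u ++ a, b ++ v, l, r, hg, by simp, by simp⟩

theorem CtxStep.reflTransGen_of_perm {Γ Γ' : List MLLFormula} (h : Γ.Perm Γ') :
    Relation.ReflTransGen (CtxStep CtrlGen) (Γ.map .fm) (Γ'.map .fm) := by
  induction h with
  | nil => exact .refl
  | cons A _ ih => simpa using reflTransGen_context ih [.fm A] []
  | swap A B Γ => exact .single (by simpa using of_gen (CtrlGen.swap B A) [] (Γ.map .fm))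
  | trans _ _ ih₁ ih₂ => exact ih₁.trans ih₂

/-- The empty word rewrites to `L, Γ, R`. -/
def Controlled (Γ : List MLLFormula) : Prop :=
  Relation.ReflTransGen (CtxStep CtrlGen) []
    (MLLLabel.L :: Γ.map MLLLabel.fm ++ [MLLLabel.R])

theorem Controlled.perm {Γ Γ' : List MLLFormula} (h : Controlled Γ) (hp : Γ.Perm Γ') :
    Controlled Γ' :=
  h.trans (CtxStep.reflTransGen_context (CtxStep.reflTransGen_of_perm hp) [.L] [.R])

/-- Two blocks placed side by side. -/
theorem Controlled.append {Γ Δ : List MLLFormula} (hΓ : Controlled Γ) (hΔ : Controlled Δ) :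
    Relation.ReflTransGen (CtxStep CtrlGen) []
      ((MLLLabel.L :: Γ.map MLLLabel.fm ++ [MLLLabel.R]) ++
        (MLLLabel.L :: Δ.map MLLLabel.fm ++ [MLLLabel.R])) := by
  refine hΓ.trans ?_
  simpa using CtxStep.reflTransGen_context hΔ (MLLLabel.L :: Γ.map MLLLabel.fm ++ [MLLLabel.R]) []

theorem MLLProof.controlled {Γ : List MLLFormula} (h : MLLProof Γ) : Controlled Γ := by
  induction h with
  | ax A => exact .single (by simpa using CtxStep.of_gen (CtrlGen.ax A) [] [])
  | cut S Γ A _ _ ih₁ ih₂ =>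
    refine (ih₁.append (ih₂.perm List.perm_append_comm)).tail ?_
    simpa using CtxStep.of_gen (CtrlGen.cut A) (MLLLabel.L :: S.map .fm) (Γ.map .fm ++ [MLLLabel.R])
  | tensor S Γ A B _ _ ih₁ ih₂ =>
    refine (ih₁.append ih₂).tail ?_
    simpa using CtxStep.of_gen (CtrlGen.tensor A B) (MLLLabel.L :: S.map .fm) (Γ.map .fm ++ [MLLLabel.R])
  | parr S A B _ ih =>
    refine ih.tail ?_
    simpa using CtxStep.of_gen (CtrlGen.parr A B) (MLLLabel.L :: S.map .fm) [.R]
  | exchange Γ Γ' _ hp ih => exact ih.perm hp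

theorem Controlled.mllProof {Γ : List MLLFormula} (h : Controlled Γ) : MLLProof Γ := by
  have key {w : List MLLLabel} (hw : Relation.ReflTransGen (CtxStep CtrlGen) [] w) :
      BlocksDerivable w [] [] := by
    induction hw with
    | refl => trivial
    | tail _ hs ih => exact hs.blocksDerivable ih
  exact BlocksDerivable.mllProof (acc := []) (p := []) (stk := []) (key h)

/-- Proof diagram correspondence for MLL with control: `⊢ Γ` is
derivable in MLL if and only if the empty word rewrites to `L, Γ, R` in the
control system `Σ̃_MLL`. -/
theorem mll_control_correspondence (Γ : List MLLFormula) :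
    MLLProof Γ ↔
      Relation.ReflTransGen (CtxStep CtrlGen) []
        (MLLLabel.L :: Γ.map MLLLabel.fm ++ [MLLLabel.R]) := by
  exact ⟨MLLProof.controlled, Controlled.mllProof⟩
end
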